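/- Let Γ : ℝ^N → ℝ^N be a continuous map and suppose there exist ρ, c > 0 with 4cρ < 1 such that ‖Γz‖₂ ≤ ρ + c‖z‖₂² for all z. Then Γ has a fixed point z* with ‖z*‖₂ ≤ 2ρ/(1 + √(1 - 4cρ)). -/

import Mathlib

open MeasureTheory Metric Set Filter Topology

section Brouwer

open Polynomial in
/-- Along the line `t ↦ id + t • A` the determinant is a polynomial in `t` of degree at most the
dimension, so its value at any `t` is a combination of its values at `finrank ℝ E + 1` nodes, with
weights that do not depend on `A`. -/
theorem ContinuousLinearMap.det_id_add_smul_eq_sum_lagrange_basis {E : Type*}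
    [NormedAddCommGroup E] [NormedSpace ℝ E] [FiniteDimensional ℝ E] (A : E →L[ℝ] E)
    {v : ℕ → ℝ} (hv : Function.Injective v) (t : ℝ) :
    (ContinuousLinearMap.id ℝ E + t • A).det =
      ∑ i ∈ Finset.range (Module.finrank ℝ E + 1),
        (ContinuousLinearMap.id ℝ E + v i • A).det *
          (Lagrange.basis (Finset.range (Module.finrank ℝ E + 1)) v i).eval t := by
  set M := LinearMap.toMatrix (Module.finBasis ℝ E) (Module.finBasis ℝ E) (A : E →ₗ[ℝ] E) with hM
  set p : ℝ[X] := Matrix.det ((X : ℝ[X]) • M.map C + (1 : Matrix _ _ ℝ).map C) with hp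
  have hdet (s : ℝ) : (ContinuousLinearMap.id ℝ E + s • A).det = p.eval s := by
    rw [hp, ← coe_evalRingHom, RingHom.map_det, ContinuousLinearMap.det,
      ← LinearMap.det_toMatrix (Module.finBasis ℝ E)]
    congr 1
    ext i j
    simp [hM, LinearMap.toMatrix_apply, Matrix.one_apply, Finsupp.single_apply, add_comm,
      eq_comm, apply_ite]
    exact mul_comm _ _
  have hdeg : p.degree < (Finset.range (Module.finrank ℝ E + 1)).card := by
    refine degree_le_natDegree.trans_lt ?_
    have := natDegree_det_X_add_C_le M 1
    rw [Fintype.card_fin, ← hp] at this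
    rw [Finset.card_range]
    exact_mod_cast Nat.lt_succ_of_le this
  simp_rw [hdet]
  conv_lhs => rw [Lagrange.eq_interpolate (v := v) hv.injOn hdeg]
  simp [Lagrange.interpolate_apply, eval_finsetSum]

/-- A differentiable map of constant nonzero norm has everywhere singular derivative. -/
theorem HasFDerivAt.det_eq_zero_of_norm_eq {E : Type*} [NormedAddCommGroup E]
    [InnerProductSpace ℝ E] [FiniteDimensional ℝ E] {f : E → E} {f' : E →L[ℝ] E} {x : E} {R : ℝ}
    (hR : R ≠ 0) (hf : HasFDerivAt f f' x) (hnorm : ∀ y, ‖f y‖ = R) : f'.det = 0 := by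
  by_contra hdet
  have hsq : HasFDerivAt (fun y => ‖f y‖ ^ 2) (2 • (innerSL ℝ (f x)).comp f') x := hf.norm_sq
  have hconst : HasFDerivAt (fun y => ‖f y‖ ^ 2) (0 : E →L[ℝ] ℝ) x := by
    simp only [hnorm]
    exact hasFDerivAt_const _ _
  set e := f'.toContinuousLinearEquivOfDetNeZero hdet
  have he : f' (e.symm (f x)) = f x := e.apply_symm_apply (f x)
  have h := DFunLike.congr_fun (hsq.unique hconst) (e.symm (f x))
  simp [he, hnorm, hR] at h

/-- A map that is Lipschitz on a closed ball and vanishes on the boundary sphere remains Lipschitz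
when it is extended by zero. -/
theorem LipschitzOnWith.indicator_closedBall {E F : Type*} [NormedAddCommGroup E] [NormedSpace ℝ E]
    [NormedAddCommGroup F] {g : E → F} {K : NNReal} {R : ℝ} (hR : 0 < R)
    (hg : LipschitzOnWith K g (closedBall 0 R)) (hzero : ∀ x, ‖x‖ = R → g x = 0) :
    LipschitzWith (2 * K) ((closedBall 0 R).indicator g) := by
  have hmixed {x y : E} (hx : ‖x‖ ≤ R) (hy : R < ‖y‖) : ‖g x‖ ≤ 2 * K * ‖x - y‖ := by
    have hy0 : 0 < ‖y‖ := hR.trans hy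
    have hp : ‖(R / ‖y‖) • y‖ = R := by
      rw [norm_smul, Real.norm_of_nonneg (by positivity)]
      field_simp
    have hyp : ‖y - (R / ‖y‖) • y‖ = ‖y‖ - R := by
      have : y - (R / ‖y‖) • y = (1 - R / ‖y‖) • y := by rw [sub_smul, one_smul]
      rw [this, norm_smul, Real.norm_of_nonneg (sub_nonneg.2 ((div_le_one hy0).2 hy.le))]
      field_simp
    have h1 := hg.norm_sub_le (x := x) (y := (R / ‖y‖) • y) (by simpa using hx)
      (by simpa using hp.le)
    rw [hzero _ hp, sub_zero] at h1
    have h2 := norm_sub_le_norm_sub_add_norm_sub x y ((R / ‖y‖) • y)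
    have h3 := norm_sub_norm_le y x
    rw [norm_sub_rev y x] at h3
    have : (K : ℝ) * ‖x - (R / ‖y‖) • y‖ ≤ K * (2 * ‖x - y‖) := by gcongr; linarith
    linarith
  refine LipschitzWith.of_dist_le_mul fun x y => ?_
  rw [dist_eq_norm, dist_eq_norm]
  push_cast
  rcases le_or_gt ‖x‖ R with hx | hx <;> rcases le_or_gt ‖y‖ R with hy | hy
  · rw [indicator_of_mem (by simpa using hx), indicator_of_mem (by simpa using hy)]
    have := hg.norm_sub_le (x := x) (y := y) (by simpa using hx) (by simpa using hy)
    have : 0 ≤ (K : ℝ) * ‖x - y‖ := by positivity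
    linarith
  · rw [indicator_of_mem (by simpa using hx), indicator_of_notMem (by simpa using hy), sub_zero]
    exact hmixed hx hy
  · rw [indicator_of_notMem (by simpa using hx), indicator_of_mem (by simpa using hy), zero_sub,
      norm_neg, norm_sub_rev]
    exact hmixed hy hx
  · rw [indicator_of_notMem (by simpa using hx), indicator_of_notMem (by simpa using hy), sub_zero,
      norm_zero]
    positivity

/-- A small Lipschitz perturbation of the identity is bijective. -/
theorem LipschitzWith.bijective_id_add_smul {E : Type*} [NormedAddCommGroup E] [NormedSpace ℝ E]
    [CompleteSpace E] {k : E → E} {K : NNReal} (hk : LipschitzWith K k) {t : ℝ}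
    (ht : |t| * K < 1) : Function.Bijective fun x => x + t • k x := by
  have happrox : ApproximatesLinearOn (fun x => x + t • k x)
      ((ContinuousLinearEquiv.refl ℝ E : E ≃L[ℝ] E) : E →L[ℝ] E) univ (‖t‖₊ * K) := by
    intro x _ y _
    have : x + t • k x - (y + t • k y) - (x - y) = t • (k x - k y) := by
      rw [smul_sub]; abel
    simp only [ContinuousLinearEquiv.coe_refl, ContinuousLinearMap.coe_id', id_eq, this, norm_smul]
    push_cast
    rw [mul_assoc]
    gcongr
    exact hk.norm_sub_le x y
  have hc : Subsingleton E ∨ ‖t‖₊ * K <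
      ‖((ContinuousLinearEquiv.refl ℝ E).symm : E →L[ℝ] E)‖₊⁻¹ := by
    rcases subsingleton_or_nontrivial E with h | h
    · exact Or.inl h
    · right
      have : ‖((ContinuousLinearEquiv.refl ℝ E).symm : E →L[ℝ] E)‖₊ = 1 := by
        ext; simp
      rw [this, inv_one, ← NNReal.coe_lt_coe]
      simpa using ht
  exact ⟨injOn_univ.1 (happrox.injOn hc), happrox.surjective hc⟩

/-- There is no continuously differentiable retraction of a closed ball onto its boundary. -/
theorem not_contDiff_retraction_sphere {E : Type*} [NormedAddCommGroup E]
    [InnerProductSpace ℝ E] [FiniteDimensional ℝ E] {f : E → E} {R : ℝ} (hR : 0 < R)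
    (hf : ContDiff ℝ 1 f) (hnorm : ∀ x, ‖f x‖ = R) (hfix : ∀ x, ‖x‖ = R → f x = x) : False := by
  borelize E
  set B : Set E := closedBall 0 R with hB
  have hBc : IsCompact B := isCompact_closedBall 0 R
  set A : E → E →L[ℝ] E := fun x => fderiv ℝ f x - ContinuousLinearMap.id ℝ E with hA
  have hAc : Continuous A := (hf.continuous_fderiv one_ne_zero).sub continuous_const
  have hg (x : E) : HasFDerivAt (fun x => f x - x) (A x) x :=
    ((hf.differentiable one_ne_zero) x).hasFDerivAt.sub (hasFDerivAt_id x)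
  obtain ⟨K, hK⟩ : ∃ K : NNReal, LipschitzOnWith K (fun x => f x - x) B := by
    obtain ⟨C, hC⟩ := hBc.exists_bound_of_continuousOn hAc.continuousOn
    refine ⟨C.toNNReal, (convex_closedBall 0 R).lipschitzOnWith_of_nnnorm_hasFDerivWithin_le
      (fun x _ => (hg x).hasFDerivWithinAt) fun x hx => ?_⟩
    rw [← NNReal.coe_le_coe, coe_nnnorm]
    exact (hC x hx).trans (Real.le_coe_toNNReal C)
  have hk := hK.indicator_closedBall hR fun x hx => sub_eq_zero.2 (hfix x hx)
  have hdetc : Continuous fun q : ℝ × E => (ContinuousLinearMap.id ℝ E + q.1 • A q.2).det :=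
    ContinuousLinearMap.continuous_det.comp (by fun_prop)
  -- For small `t` the map `x ↦ x + t • (f x - x)` permutes the ball and preserves orientation.
  have hsmall : ∀ᶠ t in 𝓝 (0 : ℝ),
      ∫ x in B, (ContinuousLinearMap.id ℝ E + t • A x).det = volume.real B := by
    have hpos : ∀ᶠ t in 𝓝 (0 : ℝ), ∀ x ∈ B, 0 < (ContinuousLinearMap.id ℝ E + t • A x).det := by
      refine hBc.eventually_forall_of_forall_eventually fun x _ => ?_
      refine hdetc.continuousAt.eventually_const_lt ?_
      simp [ContinuousLinearMap.det]
    have hlip : ∀ᶠ t in 𝓝 (0 : ℝ), |t| * ((2 * K : NNReal) : ℝ) < 1 := by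
      have : Continuous fun t : ℝ => |t| * ((2 * K : NNReal) : ℝ) := by fun_prop
      exact this.continuousAt.eventually_lt_const (by simp)
    filter_upwards [hpos, hlip] with t hpos hlip
    have hbij := hk.bijective_id_add_smul hlip
    set φ : E → E := fun x => x + t • B.indicator (fun x => f x - x) x with hφ
    have hout {x : E} (hx : x ∉ B) : φ x = x := by simp [hφ, hx]
    have himage : φ '' B = B := by
      ext y
      refine ⟨?_, fun hy => ?_⟩
      · rintro ⟨x, hx, rfl⟩
        by_contra hφx
        exact hφx ((hbij.injective (hout hφx)).symm ▸ hx)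
      · obtain ⟨x, rfl⟩ := hbij.surjective y
        by_contra hφx
        have hx : x ∉ B := fun hx => hφx ⟨x, hx, rfl⟩
        exact hx (hout hx ▸ hy)
    have hderiv (x : E) (hx : x ∈ B) :
        HasFDerivWithinAt φ (ContinuousLinearMap.id ℝ E + t • A x) B x := by
      have h := ((hasFDerivAt_id x).add ((hg x).const_smul t)).hasFDerivWithinAt (s := B)
      exact HasFDerivWithinAt.congr h (fun y hy => by simp [hφ, hy]) (by simp [hφ, hx])
    have hcov := integral_image_eq_integral_abs_det_fderiv_smul volume hBc.measurableSet hderiv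
      hbij.injective.injOn (fun _ => (1 : ℝ))
    rw [himage] at hcov
    simp only [smul_eq_mul, mul_one, integral_const, measureReal_restrict_apply_univ] at hcov
    rw [hcov]
    exact setIntegral_congr_fun hBc.measurableSet fun x hx => (abs_of_pos (hpos x hx)).symm
  obtain ⟨ε, hε, hball⟩ := Metric.eventually_nhds_iff.1 hsmall
  set v : ℕ → ℝ := fun i => ε / (i + 2) with hv
  have hvinj : Function.Injective v := fun i j hij => by
    have hi : (i : ℝ) + 2 ≠ 0 := by positivity
    have hj : (j : ℝ) + 2 ≠ 0 := by positivity
    simp only [hv, div_eq_div_iff hi hj, mul_eq_mul_left_iff, hε.ne', or_false] at hij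
    exact_mod_cast (add_right_cancel hij).symm
  have hvol (i : ℕ) :
      ∫ x in B, (ContinuousLinearMap.id ℝ E + v i • A x).det = volume.real B := by
    refine hball ?_
    rw [Real.dist_0_eq_abs, abs_of_pos (by positivity)]
    refine div_lt_self hε ?_
    have : (0 : ℝ) ≤ i := i.cast_nonneg
    linarith
  have hone : ∫ x in B, (ContinuousLinearMap.id ℝ E + (1 : ℝ) • A x).det = volume.real B := by
    simp_rw [ContinuousLinearMap.det_id_add_smul_eq_sum_lagrange_basis _ hvinj 1]
    rw [integral_finsetSum]
    · simp_rw [integral_mul_const, hvol, ← Finset.mul_sum, ← Polynomial.eval_finsetSum]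
      rw [Lagrange.sum_basis hvinj.injOn (by simp)]
      simp
    · intro i _
      refine Integrable.mul_const ?_ _
      exact ((hdetc.comp (Continuous.prodMk_right (v i))).continuousOn).integrableOn_compact hBc
  have hzero (x : E) : (ContinuousLinearMap.id ℝ E + (1 : ℝ) • A x).det = 0 := by
    rw [one_smul, hA, add_sub_cancel]
    exact ((hf.differentiable one_ne_zero) x).hasFDerivAt.det_eq_zero_of_norm_eq hR.ne' hnorm
  simp only [hzero, integral_zero] at hone
  have : 0 < volume.real B :=
    ENNReal.toReal_pos (measure_closedBall_pos volume 0 hR).ne' hBc.measure_lt_top.ne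
  exact this.ne hone

/-- A continuously differentiable self-map vanishing outside a ball has a fixed point. -/
theorem ContDiff.exists_fixedPoint_of_eq_zero {E : Type*} [NormedAddCommGroup E]
    [InnerProductSpace ℝ E] [FiniteDimensional ℝ E] {g : E → E} {R : ℝ} (hR : 0 < R)
    (hg : ContDiff ℝ 1 g) (hzero : ∀ x, R ≤ ‖x‖ → g x = 0) : ∃ x, g x = x := by
  by_contra! hne
  have hne' (x : E) : x - g x ≠ 0 := sub_ne_zero.2 (hne x).symm
  have hd : ContDiff ℝ 1 fun x => x - g x := contDiff_id.sub hg
  refine not_contDiff_retraction_sphere (f := fun x => (R / ‖x - g x‖) • (x - g x)) hR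
    ((contDiff_const.div (hd.norm ℝ hne') fun x => norm_ne_zero_iff.2 (hne' x)).smul hd)
    (fun x => ?_) fun x hx => ?_
  · have := norm_pos_iff.2 (hne' x)
    rw [norm_smul, Real.norm_of_nonneg (by positivity)]
    field_simp
  · simp [hzero x hx.ge, hx, hR.ne']

/-- A continuous self-map vanishing outside a ball has a fixed point. -/
theorem Continuous.exists_fixedPoint_of_eq_zero {E : Type*} [NormedAddCommGroup E]
    [InnerProductSpace ℝ E] [FiniteDimensional ℝ E] {g : E → E} {R : ℝ} (hR : 0 < R)
    (hg : Continuous g) (hzero : ∀ x, R ≤ ‖x‖ → g x = 0) : ∃ x, g x = x := by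
  obtain ⟨x, -, hmin⟩ := (isCompact_closedBall (0 : E) R).exists_isMinOn
    ⟨0, mem_closedBall_self hR.le⟩ (f := fun x => dist x (g x)) (by fun_prop)
  refine ⟨x, ?_⟩
  by_contra hne
  have hpos : 0 < dist x (g x) := dist_pos.2 (Ne.symm hne)
  obtain ⟨h, hh, happrox, hsupp⟩ :=
    hg.exists_contDiff_approx 1 (ε := fun _ => dist x (g x)) continuous_const fun _ => hpos
  have hhzero (y : E) (hy : R ≤ ‖y‖) : h y = 0 := by
    by_contra hne
    exact hsupp hne (hzero y hy)
  obtain ⟨y, hy⟩ := ContDiff.exists_fixedPoint_of_eq_zero hR (by exact_mod_cast hh) hhzero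
  have hyR : ‖y‖ ≤ R := by
    by_contra! hlt
    rw [hhzero y hlt.le] at hy
    rw [← hy, norm_zero] at hlt
    exact hR.not_gt hlt
  have h1 := happrox y
  rw [hy] at h1
  exact (hmin (show y ∈ closedBall 0 R by simpa using hyR)).not_gt h1

/-- **Brouwer's fixed point theorem** for a closed ball. -/
theorem ContinuousOn.exists_fixedPoint_closedBall {E : Type*} [NormedAddCommGroup E]
    [InnerProductSpace ℝ E] [FiniteDimensional ℝ E] {f : E → E} {r : ℝ} (hr : 0 < r)
    (hf : ContinuousOn f (closedBall 0 r))
    (hmaps : MapsTo f (closedBall 0 r) (closedBall 0 r)) : ∃ x ∈ closedBall 0 r, f x = x := by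
  have hmax (x : E) : 0 < max r ‖x‖ := lt_max_of_lt_left hr
  set p : E → E := fun x => (r / max r ‖x‖) • x with hp
  have hpc : Continuous p :=
    (continuous_const.div (by fun_prop) fun x => (hmax x).ne').smul continuous_id
  have hpmem (x : E) : p x ∈ closedBall 0 r := by
    rw [mem_closedBall_zero_iff, norm_smul, Real.norm_of_nonneg (by have := hmax x; positivity),
      div_mul_eq_mul_div, div_le_iff₀ (hmax x)]
    gcongr
    exact le_max_right _ _
  set χ : E → ℝ := fun x => max 0 (min 1 (r + 1 - ‖x‖)) with hχ
  have hχc : Continuous χ := by fun_prop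
  have hfc : Continuous fun x => f (p x) := hf.comp_continuous hpc hpmem
  obtain ⟨x, hx⟩ := Continuous.exists_fixedPoint_of_eq_zero (g := fun x => χ x • f (p x))
    (R := r + 1) (by linarith) (hχc.smul hfc) fun x hx => by
      have : χ x = 0 := max_eq_left ((min_le_right _ _).trans (by linarith))
      simp [this]
  have hxr : ‖x‖ ≤ r := by
    have h0 : 0 ≤ χ x := le_max_left _ _
    have h1 : χ x ≤ 1 := max_le zero_le_one (min_le_left _ _)
    have hfp : ‖f (p x)‖ ≤ r := by simpa using hmaps (hpmem x)
    rw [← hx, norm_smul, Real.norm_of_nonneg h0]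
    exact (mul_le_of_le_one_left (norm_nonneg _) h1).trans hfp
  have hχx : χ x = 1 := by
    simp only [hχ]
    rw [min_eq_left (by linarith), max_eq_right zero_le_one]
  have hpx : p x = x := by simp [hp, max_eq_left hxr, hr.ne']
  exact ⟨x, by simpa using hxr, by simpa [hχx, hpx] using hx⟩

end Brouwer


/-- Let `Γ : ℝ^N → ℝ^N` be continuous and suppose there are `ρ, c > 0` with `4cρ < 1` such
that `‖Γ z‖₂ ≤ ρ + c ‖z‖₂²` for all `z`. Then `Γ` has a fixed point `z*` with
`‖z*‖₂ ≤ 2ρ/(1 + √(1 - 4cρ))`. -/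
theorem fixed_point_of_quadratically_bounded_map (N : ℕ) (hN : 0 < N)
    (Γ : EuclideanSpace ℝ (Fin N) → EuclideanSpace ℝ (Fin N))
    (hΓ : Continuous Γ) (ρ c : ℝ) (hρ : 0 < ρ) (hc : 0 < c) (h4 : 4 * c * ρ < 1)
    (hbound : ∀ z, ‖Γ z‖ ≤ ρ + c * ‖z‖ ^ 2) :
    ∃ z : EuclideanSpace ℝ (Fin N), Γ z = z ∧
      ‖z‖ ≤ 2 * ρ / (1 + Real.sqrt (1 - 4 * c * ρ)) := by
  set s := Real.sqrt (1 - 4 * c * ρ) with hs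
  have hs0 : 0 ≤ s := Real.sqrt_nonneg _
  have hsq : s ^ 2 = 1 - 4 * c * ρ := Real.sq_sqrt (by linarith)
  set r := 2 * ρ / (1 + s) with hr
  have hr0 : 0 < r := by positivity
  -- `r` is the smaller root of `c * r ^ 2 - r + ρ`.
  have hroot : ρ + c * r ^ 2 = r := by
    rw [hr]
    field_simp
    linear_combination hsq
  obtain ⟨z, hz, hfix⟩ := ContinuousOn.exists_fixedPoint_closedBall hr0 hΓ.continuousOn
    fun z hz => by
      rw [mem_closedBall_zero_iff] at hz ⊢
      calc ‖Γ z‖ ≤ ρ + c * ‖z‖ ^ 2 := hbound z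
        _ ≤ ρ + c * r ^ 2 := by gcongr
        _ = r := hroot
  exact ⟨z, hfix, by simpa using hz⟩
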